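/- arXiv:1407.7121 — 2 statements merged into one kernel-verified Lean document; each statement's English description precedes it below -/
import Mathlib

section
/- Let n ≥ 3 and R > 0. Let F : ℝ² → ℝ be continuously differentiable with F(0,0) = 0, and suppose that ((n−2)/2)(u F_u(u,v) + v F_v(u,v)) − n F(u,v) > 0 for every (u,v) with u ≥ 0, v ≥ 0 and (u,v) ≠ (0,0). Then there is no pair of functions u, v, each twice continuously differentiable on a neighborhood of the closed ball B̄_R ⊂ ℝ^n, such that −Δu = F_v(u,v) and −Δv = F_u(u,v) in B_R, u > 0 and v > 0 in B_R, and u = v = 0 on ∂B_R. -/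
noncomputable section
open Set Metric
open scoped BigOperators

/-- The Laplace operator on `ℝ^n`, as the sum of second partial derivatives. -/
def lap {n : ℕ} (u : EuclideanSpace ℝ (Fin n) → ℝ) (x : EuclideanSpace ℝ (Fin n)) : ℝ :=
  ∑ i, fderiv ℝ (fun y => fderiv ℝ u y (EuclideanSpace.single i 1)) x (EuclideanSpace.single i 1)

/-- The partial derivative of `F : ℝ² → ℝ` with respect to its first argument. -/
def Fu (F : ℝ → ℝ → ℝ) (u v : ℝ) : ℝ := deriv (fun s => F s v) u

/-- The partial derivative of `F : ℝ² → ℝ` with respect to its second argument. -/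
def Fv (F : ℝ → ℝ → ℝ) (u v : ℝ) : ℝ := deriv (fun t => F u t) v

open MeasureTheory Filter Topology

lemma deriv_smoothTransition_of_nonpos {t : ℝ} (ht : t ≤ 0) :
    deriv Real.smoothTransition t = 0 :=
  IsLocalMin.deriv_eq_zero <| Eventually.of_forall fun s => by
    simpa [Real.smoothTransition.zero_of_nonpos ht] using Real.smoothTransition.nonneg s

lemma deriv_smoothTransition_of_one_le {t : ℝ} (ht : 1 ≤ t) :
    deriv Real.smoothTransition t = 0 :=
  IsLocalMax.deriv_eq_zero <| Eventually.of_forall fun s => by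
    simpa [Real.smoothTransition.one_of_one_le ht] using Real.smoothTransition.le_one s

lemma continuous_deriv_smoothTransition : Continuous (deriv Real.smoothTransition) :=
  (Real.smoothTransition.contDiff (n := 1)).continuous_deriv le_rfl

lemma exists_deriv_smoothTransition_le : ∃ M, 0 ≤ M ∧ ∀ t, deriv Real.smoothTransition t ≤ M := by
  obtain ⟨M, hM⟩ := (isCompact_Icc (a := (0 : ℝ)) (b := 1)).exists_bound_of_continuousOn
    continuous_deriv_smoothTransition.continuousOn
  have hM0 : 0 ≤ M := (norm_nonneg _).trans (hM 0 (by simp))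
  refine ⟨M, hM0, fun t => ?_⟩
  rcases le_or_gt t 0 with h | h
  · rw [deriv_smoothTransition_of_nonpos h]; exact hM0
  rcases le_or_gt 1 t with h' | h'
  · rw [deriv_smoothTransition_of_one_le h']; exact hM0
  exact (le_abs_self _).trans (hM t ⟨h.le, h'.le⟩)

/-- A radial cutoff, equal to `1` where `k * (R ^ 2 - ‖x‖ ^ 2) ≥ 1` and vanishing off `ball 0 R`. -/
def radialCutoff {E : Type*} [NormedAddCommGroup E] (R k : ℝ) (x : E) : ℝ :=
  Real.smoothTransition (k * (R ^ 2 - ‖x‖ ^ 2))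

section Cutoff

variable {E : Type*} [NormedAddCommGroup E] {R k : ℝ}

lemma radialCutoff_of_notMem_ball (hR : 0 < R) (hk : 0 ≤ k) {x : E} (hx : x ∉ ball (0 : E) R) :
    radialCutoff R k x = 0 := by
  rw [mem_ball_zero_iff, not_lt] at hx
  exact Real.smoothTransition.zero_of_nonpos (mul_nonpos_of_nonneg_of_nonpos hk (by nlinarith))

lemma hasFDerivAt_radialCutoff [InnerProductSpace ℝ E] (x : E) :
    HasFDerivAt (radialCutoff R k : E → ℝ)
      ((deriv Real.smoothTransition (k * (R ^ 2 - ‖x‖ ^ 2)) * (-2 * k)) • innerSL ℝ x) x := by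
  have h1 : HasFDerivAt (fun y : E => k * (R ^ 2 - ‖y‖ ^ 2)) (k • -((2 : ℕ) • innerSL ℝ x : E →L[ℝ] ℝ)) x :=
    ((hasStrictFDerivAt_norm_sq x).hasFDerivAt.const_sub _).const_mul k
  have h2 : HasDerivAt Real.smoothTransition
      (deriv Real.smoothTransition (k * (R ^ 2 - ‖x‖ ^ 2))) (k * (R ^ 2 - ‖x‖ ^ 2)) :=
    ((Real.smoothTransition.contDiff (n := 1)).differentiable (by simp) _).hasDerivAt
  refine (h2.comp_hasFDerivAt x h1).congr_fderiv ?_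
  ext y
  simp
  ring

lemma continuous_radialCutoff : Continuous (radialCutoff R k : E → ℝ) :=
  Real.smoothTransition.continuous.comp (by fun_prop)

end Cutoff

lemma exists_neg_mul_le_of_nonneg_on_sphere {E : Type*} [NormedAddCommGroup E] [NormedSpace ℝ E]
    [FiniteDimensional ℝ E] {R : ℝ} (hR : 0 < R) {p : E → ℝ}
    (hp : ContDiffOn ℝ 1 p (closedBall 0 R)) (hs : ∀ x ∈ sphere (0 : E) R, 0 ≤ p x)
    (h0 : 0 ≤ p 0) :
    ∃ C, 0 ≤ C ∧ ∀ x ∈ ball (0 : E) R, -(C * (R ^ 2 - ‖x‖ ^ 2)) ≤ p x := by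
  obtain ⟨K, hK⟩ := hp.exists_lipschitzOnWith one_ne_zero (convex_closedBall _ _)
    (isCompact_closedBall _ _)
  refine ⟨K / R, by positivity, fun x hx => ?_⟩
  rw [mem_ball_zero_iff] at hx
  have hd : 0 ≤ R ^ 2 - ‖x‖ ^ 2 := by nlinarith [norm_nonneg x]
  rcases eq_or_ne x 0 with rfl | hx0
  · exact (neg_nonpos.2 (by positivity)).trans h0
  have hxp : 0 < ‖x‖ := norm_pos_iff.2 hx0
  set y : E := (R / ‖x‖) • x with hy
  have hyn : ‖y‖ = R := by
    rw [hy, norm_smul, Real.norm_of_nonneg (by positivity)]; field_simp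
  have hyx : dist x y = R - ‖x‖ := by
    have : x - y = (1 - R / ‖x‖) • x := by rw [hy]; module
    rw [dist_eq_norm, this, norm_smul, Real.norm_of_nonpos, neg_sub, sub_mul]
    · field_simp
    · rw [sub_nonpos, le_div_iff₀ hxp]; linarith
  have h1 := hK.dist_le_mul x (by simpa using hx.le) y (by simpa using hyn.le)
  rw [hyx, Real.dist_eq] at h1
  have h2 := hs y (by simpa using hyn)
  have h3 : (K : ℝ) * (R - ‖x‖) ≤ K / R * (R ^ 2 - ‖x‖ ^ 2) := by
    rw [div_mul_eq_mul_div, le_div_iff₀ hR, mul_assoc]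
    gcongr
    nlinarith
  linarith [neg_abs_le (p x - p y)]

/-- A one-sided divergence theorem on a ball: a `C¹` field pointing outwards along the boundary
sphere has nonnegative total divergence. -/
theorem integral_divergence_ball_nonneg {n : ℕ} {R : ℝ} (hR : 0 < R)
    {U : Set (EuclideanSpace ℝ (Fin n))} (hU : IsOpen U)
    (hRU : closedBall (0 : EuclideanSpace ℝ (Fin n)) R ⊆ U)
    {W : Fin n → EuclideanSpace ℝ (Fin n) → ℝ} (hW : ∀ i, ContDiffOn ℝ 1 (W i) U)
    (hs : ∀ x ∈ sphere (0 : EuclideanSpace ℝ (Fin n)) R, 0 ≤ ∑ i, x i * W i x) :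
    0 ≤ ∫ x in ball (0 : EuclideanSpace ℝ (Fin n)) R,
      ∑ i, fderiv ℝ (W i) x (EuclideanSpace.single i 1) := by
  set B := ball (0 : EuclideanSpace ℝ (Fin n)) R
  set h : EuclideanSpace ℝ (Fin n) → ℝ := fun x => ∑ i, fderiv ℝ (W i) x (EuclideanSpace.single i 1)
  have hBc : B ⊆ closedBall 0 R := ball_subset_closedBall
  have hWc : ∀ i, ContinuousOn (W i) (closedBall 0 R) := fun i =>
    (hW i).continuousOn.mono hRU
  have hDc : ∀ i, ContinuousOn (fun x => fderiv ℝ (W i) x (EuclideanSpace.single i 1))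
      (closedBall 0 R) := fun i =>
    (((hW i).continuousOn_fderiv_of_isOpen hU le_rfl).mono hRU).clm_apply continuousOn_const
  have hint : ∀ {f : EuclideanSpace ℝ (Fin n) → ℝ}, ContinuousOn f (closedBall 0 R) → IntegrableOn f B :=
    fun hf => (hf.integrableOn_compact (isCompact_closedBall _ _)).mono_set hBc
  have hhc : ContinuousOn h (closedBall 0 R) := continuousOn_finsetSum _ fun i _ => hDc i
  obtain ⟨M, hM0, hM⟩ := exists_deriv_smoothTransition_le
  obtain ⟨C, hC0, hC⟩ := exists_neg_mul_le_of_nonneg_on_sphere hR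
    (p := fun x => ∑ i, x i * W i x)
    (ContDiffOn.sum fun i _ => ContDiffOn.mul (by fun_prop) ((hW i).mono hRU)) hs (by simp)
  set A : ℕ → Set (EuclideanSpace ℝ (Fin n)) := fun k => {x | (k : ℝ) * (R ^ 2 - ‖x‖ ^ 2) ≤ 1}
  have hA : ∀ k, MeasurableSet (A k) := fun k =>
    (isClosed_le (by fun_prop) continuous_const).measurableSet
  have hc0 : ∀ k : ℕ, ∀ x, x ∉ B → radialCutoff R k x = 0 := fun k x hx =>
    radialCutoff_of_notMem_ball hR k.cast_nonneg hx
  have hd0 : ∀ k : ℕ, ∀ x, x ∉ B → ∀ w, fderiv ℝ (radialCutoff R k) x w = 0 := by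
    intro k x hx w
    rw [(hasFDerivAt_radialCutoff x).fderiv, deriv_smoothTransition_of_nonpos]
    · simp
    · rw [mem_ball_zero_iff, not_lt] at hx
      exact mul_nonpos_of_nonneg_of_nonpos k.cast_nonneg (by nlinarith)
  have hdc : ∀ k : ℕ, ∀ w, Continuous fun x : EuclideanSpace ℝ (Fin n) => fderiv ℝ (radialCutoff R k) x w := by
    intro k w
    simp_rw [fun x : EuclideanSpace ℝ (Fin n) => (hasFDerivAt_radialCutoff (R := R) (k := k) x).fderiv]
    have := continuous_deriv_smoothTransition
    simp only [smul_apply, innerSL_apply_apply]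
    fun_prop
  have hibp : ∀ k : ℕ, ∀ i, ∫ x in B, radialCutoff R k x *
      fderiv ℝ (W i) x (EuclideanSpace.single i 1) =
      - ∫ x in B, fderiv ℝ (radialCutoff R k) x (EuclideanSpace.single i 1) * W i x := by
    intro k i
    have key : ∀ {f : EuclideanSpace ℝ (Fin n) → ℝ}, ContinuousOn f (closedBall 0 R) → (∀ x ∉ B, f x = 0) →
        Integrable f := fun hf h0 =>
      (integrableOn_iff_integrable_of_support_subset
        (Function.support_subset_iff'.2 h0)).1 (hint hf)
    rw [setIntegral_eq_integral_of_forall_compl_eq_zero (fun x hx => by rw [hc0 k x hx, zero_mul]),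
      setIntegral_eq_integral_of_forall_compl_eq_zero (fun x hx => by rw [hd0 k x hx, zero_mul])]
    refine integral_mul_fderiv_eq_neg_fderiv_mul_of_integrable (key ?_ ?_) (key ?_ ?_) (key ?_ ?_)
      ?_ ?_
    · exact (hdc k _).continuousOn.mul (hWc i)
    · intro x hx; rw [hd0 k x hx, zero_mul]
    · exact continuous_radialCutoff.continuousOn.mul (hDc i)
    · intro x hx; rw [hc0 k x hx, zero_mul]
    · exact continuous_radialCutoff.continuousOn.mul (hWc i)
    · intro x hx; rw [hc0 k x hx, zero_mul]
    · exact fun x _ => (hasFDerivAt_radialCutoff x).differentiableAt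
    · intro x hx
      have hxc : x ∈ closedBall 0 R :=
        closure_minimal ((Function.support_subset_iff'.2 (hc0 k)).trans hBc) isClosed_closedBall hx
      exact ((hW i).differentiableOn one_ne_zero).differentiableAt (hU.mem_nhds (hRU hxc))
  have hfin : volume B ≠ ⊤ := measure_ball_lt_top.ne
  have hiA : ∀ k, IntegrableOn ((A k).indicator fun _ => 2 * M * C) B := fun k =>
    (integrableOn_const (C := 2 * M * C) hfin).indicator (hA k)
  have hφh : ∀ k : ℕ, IntegrableOn (fun x => radialCutoff R k x * h x) B := fun k =>
    hint (continuous_radialCutoff.continuousOn.mul hhc)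
  have hnonneg : ∀ k : ℕ, 0 ≤ ∫ x in B,
      (radialCutoff R k x * h x + (A k).indicator (fun _ => 2 * M * C) x) := by
    intro k
    rw [integral_add (hφh k) (hiA k)]
    have e1 : ∫ x in B, radialCutoff R k x * h x =
        ∫ x in B, -∑ i, fderiv ℝ (radialCutoff R k) x (EuclideanSpace.single i 1) * W i x := by
      simp_rw [h, Finset.mul_sum]
      rw [integral_neg, integral_finsetSum, integral_finsetSum]
      · simp_rw [hibp, Finset.sum_neg_distrib]
      · exact fun i _ => hint ((hdc k _).continuousOn.mul (hWc i))
      · exact fun i _ => hint (continuous_radialCutoff.continuousOn.mul (hDc i))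
    have hi : IntegrableOn (fun x => -∑ i, fderiv ℝ (radialCutoff R k) x
        (EuclideanSpace.single i 1) * W i x) B :=
      hint (continuousOn_finsetSum _ fun i _ => (hdc k _).continuousOn.mul (hWc i)).neg
    rw [e1, ← integral_add hi (hiA k)]
    refine setIntegral_nonneg measurableSet_ball fun x hx => ?_
    set d := R ^ 2 - ‖x‖ ^ 2 with hd
    have hd0 : 0 ≤ d := by
      rw [mem_ball_zero_iff] at hx
      nlinarith [norm_nonneg x]
    have e2 : -∑ i, fderiv ℝ (radialCutoff R k) x (EuclideanSpace.single i 1) * W i x =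
        2 * k * deriv Real.smoothTransition (k * d) * ∑ i, x i * W i x := by
      rw [(hasFDerivAt_radialCutoff x).fderiv, Finset.mul_sum, ← Finset.sum_neg_distrib]
      refine Finset.sum_congr rfl fun i _ => ?_
      simp [EuclideanSpace.inner_single_right, ← hd]
      ring
    rw [e2]
    by_cases hxA : x ∈ A k
    · rw [indicator_of_mem hxA]
      have hη : 0 ≤ deriv Real.smoothTransition (k * d) :=
        Real.smoothTransition.monotone.deriv_nonneg
      have hkd : k * d ≤ 1 := hxA
      have h1 : 2 * k * deriv Real.smoothTransition (k * d) * -(C * d) ≤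
          2 * k * deriv Real.smoothTransition (k * d) * ∑ i, x i * W i x :=
        mul_le_mul_of_nonneg_left (hC x hx) (by positivity)
      have h2 : (k * d) * (deriv Real.smoothTransition (k * d) * (2 * C)) ≤ 1 * (M * (2 * C)) :=
        mul_le_mul hkd (mul_le_mul_of_nonneg_right (hM _) (by positivity)) (by positivity)
          zero_le_one
      linarith
    · rw [indicator_of_notMem hxA, deriv_smoothTransition_of_one_le (not_le.1 hxA).le]
      simp
  refine ge_of_tendsto' (tendsto_integral_of_dominated_convergence
    (fun x => |h x| + 2 * M * C) (fun k => ?_) ?_ (fun k => ?_) ?_) hnonneg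
  · exact ((hφh k).add (hiA k)).aestronglyMeasurable
  · exact (hint hhc).abs.add (integrableOn_const hfin)
  · refine Eventually.of_forall fun x => (norm_add_le _ _).trans (add_le_add ?_ ?_)
    · rw [norm_mul, radialCutoff, Real.norm_of_nonneg (Real.smoothTransition.nonneg _), Real.norm_eq_abs]
      exact mul_le_of_le_one_left (abs_nonneg _) (Real.smoothTransition.le_one _)
    · refine (norm_indicator_le_norm_self _ _).trans_eq ?_
      exact Real.norm_of_nonneg (by positivity)
  · refine (ae_restrict_iff' measurableSet_ball).2 (Eventually.of_forall fun x hx => ?_)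
    have hd : 0 < R ^ 2 - ‖x‖ ^ 2 := by
      rw [mem_ball_zero_iff] at hx
      nlinarith [norm_nonneg x]
    refine tendsto_const_nhds.congr' ?_
    obtain ⟨N, hN⟩ := exists_nat_gt (1 / (R ^ 2 - ‖x‖ ^ 2))
    filter_upwards [eventually_ge_atTop N] with k hk
    have hk1 : 1 < k * (R ^ 2 - ‖x‖ ^ 2) := by
      rw [div_lt_iff₀ hd] at hN
      exact hN.trans_le (by gcongr)
    rw [indicator_of_notMem (by simpa [A] using hk1), radialCutoff,
      Real.smoothTransition.one_of_one_le hk1.le, one_mul, add_zero]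

/-- At a boundary zero of a function nonnegative in a ball, the derivative is a nonpositive
multiple of the outward radial direction. -/
lemma exists_fderiv_eq_smul_inner_of_nonneg_ball {E : Type*} [NormedAddCommGroup E]
    [InnerProductSpace ℝ E] {R : ℝ} (hR : 0 < R) {u : E → ℝ} (hu : ∀ y ∈ ball (0 : E) R, 0 ≤ u y)
    {x : E} (hx : x ∈ sphere (0 : E) R) (hux : u x = 0) (hd : DifferentiableAt ℝ u x) :
    ∃ a ≤ 0, ∀ w, fderiv ℝ u x w = a * inner ℝ x w := by
  have hxR : ‖x‖ = R := by simpa using hx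
  have inward : ∀ w, inner ℝ x w < 0 → 0 ≤ fderiv ℝ u x w := by
    intro w hw
    have hγ : HasDerivAt (fun t : ℝ => x + t • w) w 0 := by
      simpa using ((hasDerivAt_id (0 : ℝ)).smul_const w).const_add x
    have hder : HasDerivAt (fun t : ℝ => u (x + t • w)) (fderiv ℝ u x w) 0 :=
      HasFDerivAt.comp_hasDerivAt (0 : ℝ) (by simpa using hd.hasFDerivAt) hγ
    have hlim := hasDerivWithinAt_iff_tendsto_slope' (s := Ioi 0) (by simp) |>.1
      hder.hasDerivWithinAt
    refine ge_of_tendsto hlim ?_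
    have hsmall : ∀ᶠ t : ℝ in 𝓝[>] 0, 2 * inner ℝ x w + t * ‖w‖ ^ 2 < 0 := by
      have : Tendsto (fun t : ℝ => 2 * inner ℝ x w + t * ‖w‖ ^ 2) (𝓝[>] 0)
          (𝓝 (2 * inner ℝ x w + 0 * ‖w‖ ^ 2)) :=
        (Continuous.tendsto (by fun_prop) 0).mono_left nhdsWithin_le_nhds
      exact this.eventually_lt_const (by linarith)
    filter_upwards [hsmall, self_mem_nhdsWithin] with t ht ht0
    have ht0 : 0 < t := ht0
    have hb : x + t • w ∈ ball (0 : E) R := by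
      rw [mem_ball_zero_iff]
      refine lt_of_pow_lt_pow_left₀ 2 hR.le ?_
      rw [norm_add_sq_real, inner_smul_right, norm_smul, mul_pow, hxR, Real.norm_of_nonneg ht0.le]
      nlinarith
    rw [slope_def_field]
    simpa [hux] using div_nonneg (hu _ hb) ht0.le
  have hD : fderiv ℝ u x x ≤ 0 := by
    have := inward (-x) (by rw [inner_neg_right, real_inner_self_eq_norm_sq, hxR]; nlinarith)
    simpa using this
  have tangential : ∀ w, inner ℝ x w = 0 → 0 ≤ fderiv ℝ u x w := by
    intro w hw
    have hlim : Tendsto (fun ε : ℝ => fderiv ℝ u x w - ε * fderiv ℝ u x x) (𝓝[>] 0)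
        (𝓝 (fderiv ℝ u x w - 0 * fderiv ℝ u x x)) :=
      (Continuous.tendsto (by fun_prop) 0).mono_left nhdsWithin_le_nhds
    rw [zero_mul, sub_zero] at hlim
    refine ge_of_tendsto hlim ?_
    filter_upwards [self_mem_nhdsWithin] with ε hε
    have hε : 0 < ε := hε
    have := inward (w - ε • x) (by
      rw [inner_sub_right, hw, inner_smul_right, real_inner_self_eq_norm_sq, hxR, zero_sub,
        neg_lt_zero]
      positivity)
    simpa using this
  refine ⟨fderiv ℝ u x x / R ^ 2, div_nonpos_of_nonpos_of_nonneg hD (by positivity), fun w => ?_⟩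
  set w' := w - (inner ℝ x w / R ^ 2) • x with hw'
  have hperp : inner ℝ x w' = 0 := by
    rw [hw', inner_sub_right, inner_smul_right, real_inner_self_eq_norm_sq, hxR]
    field_simp
    ring
  have h1 := tangential w' hperp
  have h2 := tangential (-w') (by rw [inner_neg_right, hperp, neg_zero])
  have h3 : fderiv ℝ u x w' = 0 := le_antisymm (by simpa using h2) h1
  rw [hw', map_sub, map_smul, smul_eq_mul] at h3
  linear_combination h3

/-- The vector field whose divergence yields the Pohozaev identity of a Hamiltonian system. -/
def pohozaevField {n : ℕ} (F : ℝ → ℝ → ℝ) (u v : EuclideanSpace ℝ (Fin n) → ℝ) (i : Fin n)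
    (x : EuclideanSpace ℝ (Fin n)) : ℝ :=
  fderiv ℝ u x x * fderiv ℝ v x (EuclideanSpace.single i 1)
    + fderiv ℝ v x x * fderiv ℝ u x (EuclideanSpace.single i 1)
    - (∑ j, fderiv ℝ u x (EuclideanSpace.single j 1) * fderiv ℝ v x (EuclideanSpace.single j 1))
      * x i
    + F (u x) (v x) * x i
    + ((n : ℝ) - 2) / 2 * (u x * fderiv ℝ v x (EuclideanSpace.single i 1)
      + v x * fderiv ℝ u x (EuclideanSpace.single i 1))

section Pohozaev

variable {n : ℕ} {F : ℝ → ℝ → ℝ} {u v : EuclideanSpace ℝ (Fin n) → ℝ}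
  {U : Set (EuclideanSpace ℝ (Fin n))}

lemma contDiffOn_pohozaevField (hF : ContDiff ℝ 1 (Function.uncurry F)) (hU : IsOpen U)
    (hu : ContDiffOn ℝ 2 u U) (hv : ContDiffOn ℝ 2 v U) (i : Fin n) :
    ContDiffOn ℝ 1 (pohozaevField F u v i) U := by
  have hu1 : ContDiffOn ℝ 1 u U := hu.of_le (by norm_num)
  have hv1 : ContDiffOn ℝ 1 v U := hv.of_le (by norm_num)
  have hdu : ContDiffOn ℝ 1 (fderiv ℝ u) U := hu.fderiv_of_isOpen hU (by norm_num)
  have hdv : ContDiffOn ℝ 1 (fderiv ℝ v) U := hv.fderiv_of_isOpen hU (by norm_num)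
  have hFuv : ContDiffOn ℝ 1 (fun x => F (u x) (v x)) U := hF.comp_contDiffOn (hu1.prodMk hv1)
  unfold pohozaevField
  have hx : ContDiffOn ℝ 1 (fun x : EuclideanSpace ℝ (Fin n) => x i) U := by fun_prop
  have hdui : ∀ w, ContDiffOn ℝ 1 (fun x => fderiv ℝ u x w) U := fun w =>
    hdu.clm_apply contDiffOn_const
  have hdvi : ∀ w, ContDiffOn ℝ 1 (fun x => fderiv ℝ v x w) U := fun w =>
    hdv.clm_apply contDiffOn_const
  exact (((((hdu.clm_apply contDiffOn_id).mul (hdvi _)).add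
    ((hdv.clm_apply contDiffOn_id).mul (hdui _))).sub
    ((ContDiffOn.sum fun j _ => (hdui _).mul (hdvi _)).mul hx)).add (hFuv.mul hx)).add
    (contDiffOn_const.mul ((hu1.mul (hdvi _)).add (hv1.mul (hdui _))))

lemma sum_mul_pohozaevField_sphere_nonneg {R : ℝ} (hR : 0 < R) (hF0 : F 0 0 = 0)
    (hu : ∀ y ∈ ball (0 : EuclideanSpace ℝ (Fin n)) R, 0 ≤ u y)
    (hv : ∀ y ∈ ball (0 : EuclideanSpace ℝ (Fin n)) R, 0 ≤ v y)
    {x : EuclideanSpace ℝ (Fin n)} (hx : x ∈ sphere (0 : EuclideanSpace ℝ (Fin n)) R)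
    (hux : u x = 0) (hvx : v x = 0)
    (hdu : DifferentiableAt ℝ u x) (hdv : DifferentiableAt ℝ v x) :
    0 ≤ ∑ i, x i * pohozaevField F u v i x := by
  obtain ⟨a, ha, hua⟩ := exists_fderiv_eq_smul_inner_of_nonneg_ball hR hu hx hux hdu
  obtain ⟨b, hb, hvb⟩ := exists_fderiv_eq_smul_inner_of_nonneg_ball hR hv hx hvx hdv
  have hsq : ∑ i, x i * x i = inner ℝ x x := by
    simp [PiLp.inner_apply, -inner_self_eq_norm_sq_to_K]
  have h1 : ∑ i, x i * pohozaevField F u v i x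
      = ∑ i, a * b * inner ℝ x x * (x i * x i) := by
    refine Finset.sum_congr rfl fun i _ => ?_
    have h2 : ∑ j, a * x j * (b * x j) = a * b * inner ℝ x x := by
      rw [← hsq, Finset.mul_sum]
      exact Finset.sum_congr rfl fun j _ => by ring
    simp only [pohozaevField, hua, hvb, hux, hvx, hF0, EuclideanSpace.inner_single_right,
      one_mul, conj_trivial, h2]
    ring
  rw [h1, ← Finset.mul_sum, hsq, mul_assoc]
  exact mul_nonneg (mul_nonneg_of_nonpos_of_nonpos ha hb) (mul_self_nonneg _)

lemma fderiv_uncurry_apply (hF : ContDiff ℝ 1 (Function.uncurry F)) (a b s t : ℝ) :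
    fderiv ℝ (Function.uncurry F) (a, b) (s, t) = Fu F a b * s + Fv F a b * t := by
  have hd : HasFDerivAt (Function.uncurry F) (fderiv ℝ (Function.uncurry F) (a, b)) (a, b) :=
    (hF.differentiable one_ne_zero _).hasFDerivAt
  have h1 : HasDerivAt (fun r => F r b) (fderiv ℝ (Function.uncurry F) (a, b) (1, 0)) a :=
    HasFDerivAt.comp_hasDerivAt (f := fun r => (r, b)) a hd ((hasDerivAt_id a).prodMk (hasDerivAt_const a b))
  have h2 : HasDerivAt (fun r => F a r) (fderiv ℝ (Function.uncurry F) (a, b) (0, 1)) b :=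
    HasFDerivAt.comp_hasDerivAt (f := fun r => (a, r)) b hd ((hasDerivAt_const b a).prodMk (hasDerivAt_id b))
  have h3 : ((s, t) : ℝ × ℝ) = s • (1, 0) + t • (0, 1) := by simp
  rw [Fu, Fv, h1.deriv, h2.deriv, h3, map_add, map_smul, map_smul, smul_eq_mul, smul_eq_mul]
  ring

lemma divergence_pohozaevField (hF : ContDiff ℝ 1 (Function.uncurry F))
    {x : EuclideanSpace ℝ (Fin n)} (hu : ContDiffAt ℝ 2 u x) (hv : ContDiffAt ℝ 2 v x)
    (hlu : -lap u x = Fv F (u x) (v x)) (hlv : -lap v x = Fu F (u x) (v x)) :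
    ∑ i, fderiv ℝ (pohozaevField F u v i) x (EuclideanSpace.single i 1) =
      n * F (u x) (v x)
        - ((n : ℝ) - 2) / 2 * (u x * Fu F (u x) (v x) + v x * Fv F (u x) (v x)) := by
  have hdu : HasFDerivAt u (fderiv ℝ u x) x := (hu.differentiableAt two_ne_zero).hasFDerivAt
  have hdv : HasFDerivAt v (fderiv ℝ v x) x := (hv.differentiableAt two_ne_zero).hasFDerivAt
  have hddu : HasFDerivAt (fderiv ℝ u) (fderiv ℝ (fderiv ℝ u) x) x :=
    ((hu.fderiv_right (m := 1) (by norm_num)).differentiableAt one_ne_zero).hasFDerivAt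
  have hddv : HasFDerivAt (fderiv ℝ v) (fderiv ℝ (fderiv ℝ v) x) x :=
    ((hv.fderiv_right (m := 1) (by norm_num)).differentiableAt one_ne_zero).hasFDerivAt
  have hsu : IsSymmSndFDerivAt ℝ u x := hu.isSymmSndFDerivAt (by simp)
  have hsv : IsSymmSndFDerivAt ℝ v x := hv.isSymmSndFDerivAt (by simp)
  have hdui : ∀ w, HasFDerivAt (fun y => fderiv ℝ u y w)
      ((fderiv ℝ (fderiv ℝ u) x).flip w) x := fun w => by
    simpa using hddu.clm_apply (hasFDerivAt_const w x)
  have hdvi : ∀ w, HasFDerivAt (fun y => fderiv ℝ v y w)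
      ((fderiv ℝ (fderiv ℝ v) x).flip w) x := fun w => by
    simpa using hddv.clm_apply (hasFDerivAt_const w x)
  have hdux := hddu.clm_apply (hasFDerivAt_id x)
  have hdvx := hddv.clm_apply (hasFDerivAt_id x)
  have hFuv : HasFDerivAt (fun y => F (u y) (v y)) _ x :=
    HasFDerivAt.comp (f := fun y => (u y, v y)) x (hF.differentiable one_ne_zero (u x, v x)).hasFDerivAt
      (hdu.prodMk hdv)
  have hxi : ∀ i, HasFDerivAt (fun y : EuclideanSpace ℝ (Fin n) => y i)
      (EuclideanSpace.proj i : EuclideanSpace ℝ (Fin n) →L[ℝ] ℝ) x := fun i =>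
    (EuclideanSpace.proj i : EuclideanSpace ℝ (Fin n) →L[ℝ] ℝ).hasFDerivAt
  have hlapu : lap u x = ∑ i, fderiv ℝ (fderiv ℝ u) x (EuclideanSpace.single i 1)
      (EuclideanSpace.single i 1) := by
    simp [lap, (hdui _).fderiv]
  have hlapv : lap v x = ∑ i, fderiv ℝ (fderiv ℝ v) x (EuclideanSpace.single i 1)
      (EuclideanSpace.single i 1) := by
    simp [lap, (hdvi _).fderiv]
  have hsum : ∀ L : EuclideanSpace ℝ (Fin n) →L[ℝ] ℝ,
      L x = ∑ i, L (EuclideanSpace.single i 1) * x i := fun L => by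
    conv_lhs => rw [← (EuclideanSpace.basisFun (Fin n) ℝ).sum_repr x]
    simp [mul_comm]
  set c : ℝ := ((n : ℝ) - 2) / 2 with hc
  have hterm : ∀ i, fderiv ℝ (pohozaevField F u v i) x (EuclideanSpace.single i 1) =
      (2 + 2 * c) * (fderiv ℝ u x (EuclideanSpace.single i 1)
          * fderiv ℝ v x (EuclideanSpace.single i 1))
        - ∑ j, fderiv ℝ u x (EuclideanSpace.single j 1) * fderiv ℝ v x (EuclideanSpace.single j 1)
        + F (u x) (v x)
        + (fderiv ℝ u x x + c * u x) * fderiv ℝ (fderiv ℝ v) x (EuclideanSpace.single i 1)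
          (EuclideanSpace.single i 1)
        + (fderiv ℝ v x x + c * v x) * fderiv ℝ (fderiv ℝ u) x (EuclideanSpace.single i 1)
          (EuclideanSpace.single i 1)
        + Fu F (u x) (v x) * (fderiv ℝ u x (EuclideanSpace.single i 1) * x i)
        + Fv F (u x) (v x) * (fderiv ℝ v x (EuclideanSpace.single i 1) * x i)
        + (fderiv ℝ (fderiv ℝ u) x x (EuclideanSpace.single i 1)
          * fderiv ℝ v x (EuclideanSpace.single i 1)
        + fderiv ℝ (fderiv ℝ v) x x (EuclideanSpace.single i 1)
          * fderiv ℝ u x (EuclideanSpace.single i 1))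
        - (∑ j, (fderiv ℝ (fderiv ℝ u) x (EuclideanSpace.single i 1) (EuclideanSpace.single j 1)
          * fderiv ℝ v x (EuclideanSpace.single j 1)
          + fderiv ℝ (fderiv ℝ v) x (EuclideanSpace.single i 1) (EuclideanSpace.single j 1)
          * fderiv ℝ u x (EuclideanSpace.single j 1))) * x i := by
    intro i
    have hP : HasFDerivAt (pohozaevField F u v i) _ x :=
      ((((hdux.mul (hdvi (EuclideanSpace.single i 1))).add
        (hdvx.mul (hdui (EuclideanSpace.single i 1)))).sub
        ((HasFDerivAt.fun_sum fun j (_ : j ∈ Finset.univ) =>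
          (hdui (EuclideanSpace.single j 1)).mul (hdvi (EuclideanSpace.single j 1))).mul
          (hxi i))).add (hFuv.mul (hxi i))).add
        (((hdu.mul (hdvi (EuclideanSpace.single i 1))).add
          (hdv.mul (hdui (EuclideanSpace.single i 1)))).const_mul c)
    rw [hP.fderiv]
    simp [fderiv_uncurry_apply hF, hsu.eq (EuclideanSpace.single i 1) x,
      hsv.eq (EuclideanSpace.single i 1) x, Finset.sum_add_distrib, mul_comm]
    ring
  have hcross : ∑ i, (∑ j, (fderiv ℝ (fderiv ℝ u) x (EuclideanSpace.single i 1)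
          (EuclideanSpace.single j 1) * fderiv ℝ v x (EuclideanSpace.single j 1)
          + fderiv ℝ (fderiv ℝ v) x (EuclideanSpace.single i 1) (EuclideanSpace.single j 1)
          * fderiv ℝ u x (EuclideanSpace.single j 1))) * x i =
      ∑ j, (fderiv ℝ (fderiv ℝ u) x x (EuclideanSpace.single j 1)
          * fderiv ℝ v x (EuclideanSpace.single j 1)
        + fderiv ℝ (fderiv ℝ v) x x (EuclideanSpace.single j 1)
          * fderiv ℝ u x (EuclideanSpace.single j 1)) := by
    simp_rw [Finset.sum_mul]
    rw [Finset.sum_comm]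
    refine Finset.sum_congr rfl fun j _ => ?_
    have h1 := hsum ((fderiv ℝ (fderiv ℝ u) x).flip (EuclideanSpace.single j 1))
    have h2 := hsum ((fderiv ℝ (fderiv ℝ v) x).flip (EuclideanSpace.single j 1))
    simp only [ContinuousLinearMap.flip_apply] at h1 h2
    rw [h1, h2, Finset.sum_mul, Finset.sum_mul, ← Finset.sum_add_distrib]
    exact Finset.sum_congr rfl fun i _ => by ring
  rw [Finset.sum_congr rfl fun i _ => hterm i, Finset.sum_sub_distrib, hcross]
  simp only [Finset.sum_add_distrib, Finset.sum_sub_distrib, ← Finset.mul_sum, ← hlapu, ← hlapv,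
    ← hsum, Finset.sum_const, Finset.card_univ, Fintype.card_fin, nsmul_eq_mul]
  rw [← hlu, ← hlv]
  linear_combination (2 * ∑ i, fderiv ℝ u x (EuclideanSpace.single i 1)
    * fderiv ℝ v x (EuclideanSpace.single i 1)) * hc

end Pohozaev

/-- **Nonexistence for the cross-gradient Dirichlet system** `-Δu = F_v(u,v)`,
`-Δv = F_u(u,v)` on a ball of radius `R`: if `F(0,0) = 0` and
`((n-2)/2)(u F_u + v F_v) - n F > 0` on the closed first quadrant away from the origin,
then there is no positive solution vanishing on the boundary sphere. -/
theorem crossGradient_Dirichlet_nonexistence (n : ℕ) (hn : 3 ≤ n) (R : ℝ) (hR : 0 < R)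
    (F : ℝ → ℝ → ℝ) (hF : ContDiff ℝ 1 (Function.uncurry F)) (hF0 : F 0 0 = 0)
    (hPS : ∀ a b : ℝ, 0 ≤ a → 0 ≤ b → ¬(a = 0 ∧ b = 0) →
      0 < ((n:ℝ) - 2) / 2 * (a * Fu F a b + b * Fv F a b) - (n:ℝ) * F a b) :
    ¬ ∃ (u v : EuclideanSpace ℝ (Fin n) → ℝ) (U : Set (EuclideanSpace ℝ (Fin n))),
      IsOpen U ∧ closedBall (0 : EuclideanSpace ℝ (Fin n)) R ⊆ U ∧
      ContDiffOn ℝ 2 u U ∧ ContDiffOn ℝ 2 v U ∧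
      (∀ x ∈ ball (0 : EuclideanSpace ℝ (Fin n)) R, - lap u x = Fv F (u x) (v x)) ∧
      (∀ x ∈ ball (0 : EuclideanSpace ℝ (Fin n)) R, - lap v x = Fu F (u x) (v x)) ∧
      (∀ x ∈ ball (0 : EuclideanSpace ℝ (Fin n)) R, 0 < u x) ∧
      (∀ x ∈ ball (0 : EuclideanSpace ℝ (Fin n)) R, 0 < v x) ∧
      (∀ x ∈ sphere (0 : EuclideanSpace ℝ (Fin n)) R, u x = 0) ∧
      (∀ x ∈ sphere (0 : EuclideanSpace ℝ (Fin n)) R, v x = 0) := by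
  rintro ⟨u, v, U, hU, hRU, hu, hv, hlu, hlv, hupos, hvpos, hu0, hv0⟩
  have hRU' : ball (0 : EuclideanSpace ℝ (Fin n)) R ⊆ U := ball_subset_closedBall.trans hRU
  have huat : ∀ x ∈ U, ContDiffAt ℝ 2 u x := fun x hx => hu.contDiffAt (hU.mem_nhds hx)
  have hvat : ∀ x ∈ U, ContDiffAt ℝ 2 v x := fun x hx => hv.contDiffAt (hU.mem_nhds hx)
  have hW := contDiffOn_pohozaevField hF hU hu hv
  have hnonneg := integral_divergence_ball_nonneg hR hU hRU hW fun x hx =>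
    have hxU := hRU (sphere_subset_closedBall hx)
    sum_mul_pohozaevField_sphere_nonneg hR hF0 (fun y hy => (hupos y hy).le)
      (fun y hy => (hvpos y hy).le) hx (hu0 x hx) (hv0 x hx)
      ((huat x hxU).differentiableAt two_ne_zero) ((hvat x hxU).differentiableAt two_ne_zero)
  have hneg : ∀ x ∈ ball (0 : EuclideanSpace ℝ (Fin n)) R,
      0 < -∑ i, fderiv ℝ (pohozaevField F u v i) x (EuclideanSpace.single i 1) := by
    intro x hx
    rw [divergence_pohozaevField hF (huat x (hRU' hx)) (hvat x (hRU' hx)) (hlu x hx) (hlv x hx)]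
    linarith [hPS (u x) (v x) (hupos x hx).le (hvpos x hx).le fun h => (hupos x hx).ne' h.1]
  have hint : IntegrableOn
      (fun x => -∑ i, fderiv ℝ (pohozaevField F u v i) x (EuclideanSpace.single i 1))
      (ball (0 : EuclideanSpace ℝ (Fin n)) R) := by
    refine IntegrableOn.mono_set (ContinuousOn.integrableOn_compact (isCompact_closedBall 0 R) ?_)
      ball_subset_closedBall
    exact ContinuousOn.fun_neg (continuousOn_finsetSum _ fun i _ =>
      (((hW i).continuousOn_fderiv_of_isOpen hU le_rfl).mono hRU).clm_apply continuousOn_const)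
  have hpos := (setIntegral_pos_iff_support_of_nonneg_ae
    ((ae_restrict_iff' measurableSet_ball).2 (Eventually.of_forall fun x hx => (hneg x hx).le))
    hint).2 ?_
  · rw [integral_neg] at hpos
    linarith
  · rw [inter_eq_self_of_subset_right fun x hx => Function.mem_support.2 (hneg x hx).ne']
    exact measure_ball_pos volume 0 hR
end
end

section
/- Let n ≥ 3 and let p be a real number with p ≥ 2n/(n−2). Then the system −Δu = −2(u−v) + v^{p−1} + (p−1) u^{p−2} v, −Δv = 2(u−v) + (p−1) v^{p−2} u + u^{p−1} in ℝ^n, with u > 0 and v > 0 in ℝ^n, admits a twice continuously differentiable radially symmetric solution, i.e. there exist positive C² functions u, v : ℝ^n → ℝ, each depending on x only through |x|, satisfying the system on all of ℝ^n. -/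
noncomputable section
open Set Metric
open scoped BigOperators

open Real Filter MeasureTheory

/-- The weighted mean `∫₀¹ τ ^ m f(s τ²) dτ`. -/
def radialMean (m : ℕ) (f : ℝ → ℝ) (s : ℝ) : ℝ :=
  ∫ τ in (0:ℝ)..1, τ ^ m * f (s * τ ^ 2)

lemma continuous_radialMean (m : ℕ) {f : ℝ → ℝ} (hf : Continuous f) :
    Continuous (radialMean m f) := by
  unfold radialMean
  apply intervalIntegral.continuous_parametric_intervalIntegral_of_continuous'
  fun_prop

lemma sub_radialMean (m : ℕ) {f g : ℝ → ℝ} (hf : Continuous f) (hg : Continuous g) (s : ℝ) :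
    radialMean m f s - radialMean m g s = radialMean m (fun t => f t - g t) s := by
  unfold radialMean
  rw [← intervalIntegral.integral_sub]
  · simp only [mul_sub]
  · exact Continuous.intervalIntegrable (by fun_prop) _ _
  · exact Continuous.intervalIntegrable (by fun_prop) _ _

lemma hasDerivAt_radialMean (m : ℕ) {f f' : ℝ → ℝ} (hf : ∀ t, HasDerivAt f (f' t) t)
    (hf' : Continuous f') (s : ℝ) :
    HasDerivAt (radialMean m f) (radialMean (m + 2) f' s) s := by
  have hfc : Continuous f := continuous_iff_continuousAt.2 fun t => (hf t).continuousAt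
  obtain ⟨C, hC⟩ := (isCompact_closedBall (0:ℝ) (|s| + 1)).exists_bound_of_continuousOn
    hf'.continuousOn
  refine (intervalIntegral.hasDerivAt_integral_of_dominated_loc_of_deriv_le
    (F := fun x τ => τ ^ m * f (x * τ ^ 2)) (F' := fun x τ => τ ^ (m + 2) * f' (x * τ ^ 2))
    (bound := fun _ => C) (ball_mem_nhds s one_pos) (Eventually.of_forall fun x => ?_)
    ?_ ?_ (ae_of_all _ fun t ht x hx => ?_) ?_ (ae_of_all _ fun t _ x _ => ?_)).2
  · exact Continuous.aestronglyMeasurable (by fun_prop)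
  · exact Continuous.intervalIntegrable (by fun_prop) _ _
  · exact Continuous.aestronglyMeasurable (by fun_prop)
  · rw [uIoc_of_le zero_le_one] at ht
    have ht2 : t ^ 2 ≤ 1 := pow_le_one₀ ht.1.le ht.2
    have hx' : |x| ≤ |s| + 1 := by
      have h1 : |x - s| < 1 := hx
      have := abs_sub_abs_le_abs_sub x s
      linarith
    have h : ‖f' (x * t ^ 2)‖ ≤ C := by
      apply hC
      rw [mem_closedBall_zero_iff, Real.norm_eq_abs, abs_mul, abs_of_nonneg (sq_nonneg t)]
      nlinarith [abs_nonneg x, sq_nonneg t]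
    rw [norm_mul, norm_pow, Real.norm_eq_abs, abs_of_pos ht.1]
    exact (mul_le_of_le_one_left (norm_nonneg _) (pow_le_one₀ ht.1.le ht.2)).trans h
  · exact intervalIntegrable_const
  · have h1 : HasDerivAt (fun y : ℝ => y * t ^ 2) (t ^ 2) x := by
      simpa using (hasDerivAt_id x).mul_const (t ^ 2)
    have h2 := ((hf (x * t ^ 2)).comp x h1).const_mul (t ^ m)
    exact h2.congr_deriv (by ring)

lemma radialMean_deriv_identity (m : ℕ) {f f' : ℝ → ℝ} (hf : ∀ t, HasDerivAt f (f' t) t)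
    (hf' : Continuous f') (s : ℝ) :
    (m + 1) * radialMean m f s + 2 * s * radialMean (m + 2) f' s = f s := by
  have hfc : Continuous f := continuous_iff_continuousAt.2 fun t => (hf t).continuousAt
  have hd : ∀ τ ∈ uIcc (0:ℝ) 1, HasDerivAt (fun τ : ℝ => τ ^ (m + 1) * f (s * τ ^ 2))
      ((m + 1) * (τ ^ m * f (s * τ ^ 2)) + 2 * s * (τ ^ (m + 2) * f' (s * τ ^ 2))) τ := by
    intro τ _
    have h1 : HasDerivAt (fun y : ℝ => s * y ^ 2) (s * (2 * τ)) τ := by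
      simpa using (hasDerivAt_pow 2 τ).const_mul s
    have h2 := (hasDerivAt_pow (m + 1) τ).mul ((hf (s * τ ^ 2)).comp τ h1)
    refine h2.congr_deriv ?_
    push_cast
    simp only [Function.comp_apply]
    ring
  have h := intervalIntegral.integral_eq_sub_of_hasDerivAt hd
    (Continuous.intervalIntegrable (by fun_prop) _ _)
  rw [intervalIntegral.integral_add (Continuous.intervalIntegrable (by fun_prop) _ _)
    (Continuous.intervalIntegrable (by fun_prop) _ _), intervalIntegral.integral_const_mul,
    intervalIntegral.integral_const_mul] at h
  simpa [radialMean] using h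

lemma abs_radialMean_le (m : ℕ) {f : ℝ → ℝ} {C b : ℝ} (hC : 0 ≤ C) (hb : 0 ≤ b)
    (h : ∀ t, |f t| ≤ C * exp (b * |t|)) (s : ℝ) :
    |radialMean m f s| ≤ C * exp (b * |s|) := by
  have := intervalIntegral.norm_integral_le_of_norm_le_const (a := (0:ℝ)) (b := 1)
    (f := fun τ => τ ^ m * f (s * τ ^ 2)) (C := C * exp (b * |s|)) ?_
  · simpa [radialMean] using this
  · intro τ hτ
    rw [uIoc_of_le zero_le_one] at hτ
    rw [norm_mul, norm_pow, Real.norm_eq_abs, abs_of_pos hτ.1]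
    refine (mul_le_of_le_one_left (norm_nonneg _) (pow_le_one₀ hτ.1.le hτ.2)).trans ?_
    refine (h _).trans ?_
    have h1 : |s * τ ^ 2| ≤ |s| := by
      rw [abs_mul, abs_of_nonneg (sq_nonneg τ)]
      exact mul_le_of_le_one_right (abs_nonneg _) (pow_le_one₀ hτ.1.le hτ.2)
    exact mul_le_mul_of_nonneg_left (exp_le_exp.2 (mul_le_mul_of_nonneg_left h1 hb)) hC

lemma abs_integral_le_exp_of_nonneg {f : ℝ → ℝ} {C b : ℝ} (hC : 0 ≤ C) (hb : 0 < b)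
    (h : ∀ t, |f t| ≤ C * exp (b * |t|)) {s : ℝ} (hs : 0 ≤ s) :
    |∫ t in (0:ℝ)..s, f t| ≤ C / b * exp (b * s) := by
  have h1 : ‖∫ t in (0:ℝ)..s, f t‖ ≤ ∫ t in (0:ℝ)..s, C * exp (b * t) := by
    refine intervalIntegral.norm_integral_le_of_norm_le hs (ae_of_all _ fun t ht => ?_)
      (Continuous.intervalIntegrable (by fun_prop) _ _)
    simpa [abs_of_pos ht.1] using h t
  have h2 : ∫ t in (0:ℝ)..s, C * exp (b * t) = C / b * exp (b * s) - C / b := by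
    rw [intervalIntegral.integral_eq_sub_of_hasDerivAt (f := fun t => C / b * exp (b * t))]
    · simp
    · intro t _
      have h3 : HasDerivAt (fun y : ℝ => b * y) b t := by
        simpa using (hasDerivAt_id t).const_mul b
      refine (h3.exp.const_mul (C / b)).congr_deriv ?_
      field_simp
    · exact Continuous.intervalIntegrable (by fun_prop) _ _
  rw [h2] at h1
  have : 0 ≤ C / b := by positivity
  rw [Real.norm_eq_abs] at h1
  linarith

lemma abs_integral_le_exp {f : ℝ → ℝ} {C b : ℝ} (hC : 0 ≤ C) (hb : 0 < b)
    (h : ∀ t, |f t| ≤ C * exp (b * |t|)) (s : ℝ) :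
    |∫ t in (0:ℝ)..s, f t| ≤ C / b * exp (b * |s|) := by
  rcases le_total 0 s with hs | hs
  · rw [abs_of_nonneg hs]
    exact abs_integral_le_exp_of_nonneg hC hb h hs
  · have h1 := abs_integral_le_exp_of_nonneg (f := fun t => f (-t)) hC hb
      (fun t => by simpa using h (-t)) (neg_nonneg.2 hs)
    rw [intervalIntegral.integral_comp_neg, intervalIntegral.integral_symm, abs_neg] at h1
    simpa [abs_of_nonpos hs] using h1

/-- Global solvability of the radial semilinear equation in integrated form, by Banach's fixed
point theorem in a space of functions with exponential growth. -/
lemma exists_radial_integral_solution (m : ℕ) {g : ℝ → ℝ} {K : ℝ} (hK : 0 ≤ K) (hg0 : g 0 = 0)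
    (hg : ∀ x y, |g x - g y| ≤ K * |x - y|) :
    ∃ φ : ℝ → ℝ, Continuous φ ∧
      ∀ s, φ s = 1 - 1 / 2 * ∫ t in (0:ℝ)..s, radialMean m (fun r => g (φ r)) t := by
  have hgc : Continuous g := by
    have : LipschitzWith K.toNNReal g := LipschitzWith.of_dist_le_mul fun x y => by
      simpa [Real.dist_eq, hK] using hg x y
    exact this.continuous
  set b : ℝ := K + 1 with hb_def
  have hb : 0 < b := by positivity
  let E : BoundedContinuousFunction ℝ ℝ → ℝ → ℝ := fun z t => exp (b * |t|) * z t
  have hE : ∀ z, Continuous (E z) := fun z => by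
    have := z.continuous
    simp only [E]
    fun_prop
  have hEd : ∀ z w t, |g (E z t) - g (E w t)| ≤ K * dist z w * exp (b * |t|) := fun z w t => by
    refine (hg _ _).trans ?_
    have h1 : |E z t - E w t| = exp (b * |t|) * |z t - w t| := by
      simp only [E]
      rw [← mul_sub, abs_mul, abs_of_pos (exp_pos _)]
    have h2 : |z t - w t| ≤ dist z w := by
      rw [← Real.dist_eq]
      exact BoundedContinuousFunction.dist_coe_le_dist t
    rw [h1, mul_assoc, mul_comm (dist z w)]
    gcongr
  let I : BoundedContinuousFunction ℝ ℝ → ℝ → ℝ := fun z s =>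
    ∫ t in (0:ℝ)..s, radialMean m (fun r => g (E z r)) t
  have hRc : ∀ z, Continuous (radialMean m (fun r => g (E z r))) := fun z =>
    continuous_radialMean m (hgc.comp (hE z))
  have hIc : ∀ z, Continuous (I z) := fun z =>
    intervalIntegral.continuous_primitive (fun _ _ => (hRc z).intervalIntegrable _ _) _
  have hId : ∀ z w s, |I z s - I w s| ≤ dist z w * exp (b * |s|) := fun z w s => by
    have h1 : I z s - I w s
        = ∫ t in (0:ℝ)..s, radialMean m (fun r => g (E z r) - g (E w r)) t := by
      simp only [I]
      rw [← intervalIntegral.integral_sub ((hRc z).intervalIntegrable _ _)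
        ((hRc w).intervalIntegrable _ _)]
      exact intervalIntegral.integral_congr fun t _ =>
        sub_radialMean m (hgc.comp (hE z)) (hgc.comp (hE w)) t
    have hKd : 0 ≤ K * dist z w := mul_nonneg hK dist_nonneg
    rw [h1]
    refine (abs_integral_le_exp hKd hb (abs_radialMean_le m hKd hb.le (hEd z w)) s).trans ?_
    gcongr
    rw [div_le_iff₀ hb]
    nlinarith [dist_nonneg (x := z) (y := w)]
  have hI0 : ∀ s, I 0 s = 0 := fun s => by simp [I, E, hg0, radialMean]
  let T : BoundedContinuousFunction ℝ ℝ → BoundedContinuousFunction ℝ ℝ := fun z =>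
    BoundedContinuousFunction.ofNormedAddCommGroup
      (fun s => exp (-(b * |s|)) * (1 - 1 / 2 * I z s))
      (by have := hIc z; fun_prop) (1 + dist z 0) (fun s => by
        have h1 := hId z 0 s
        rw [hI0, sub_zero] at h1
        rw [Real.norm_eq_abs, abs_mul, abs_of_pos (exp_pos _), exp_neg,
          inv_mul_le_iff₀ (exp_pos _)]
        have h2 : 1 ≤ exp (b * |s|) := one_le_exp (by positivity)
        have h3 : 0 ≤ dist z 0 := dist_nonneg
        rw [abs_le] at h1 ⊢
        constructor <;> nlinarith [h1.1, h1.2])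
  have hT : ContractingWith (1 / 2) T := by
    refine ⟨by rw [← NNReal.coe_lt_coe]; norm_num, LipschitzWith.of_dist_le_mul fun z w => ?_⟩
    rw [BoundedContinuousFunction.dist_le (by positivity)]
    intro s
    have h1 : T z s - T w s = exp (-(b * |s|)) * (1 / 2) * (I w s - I z s) := by
      simp only [T, BoundedContinuousFunction.coe_ofNormedAddCommGroup]
      ring
    rw [Real.dist_eq, h1, abs_mul, abs_of_pos (by positivity), exp_neg, mul_assoc,
      inv_mul_le_iff₀ (exp_pos _)]
    have h2 := hId w z s
    rw [dist_comm w z] at h2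
    push_cast
    linarith
  refine ⟨E hT.fixedPoint, hE _, fun s => ?_⟩
  have h := congrArg (fun z => exp (b * |s|) * z s) hT.fixedPoint_isFixedPt.eq
  simp only [T, BoundedContinuousFunction.coe_ofNormedAddCommGroup] at h
  rw [← mul_assoc, ← exp_add, add_neg_cancel, exp_zero, one_mul] at h
  exact h.symm

/-- A global `C²` solution of `4 s φ'' + 2 (m + 1) φ' = - g(φ)`, `φ(0) = 1`, which is the radial
form of `-Δ w = g(w)` in dimension `m + 1` for `w(x) = φ(|x|²)`. -/
lemma exists_radial_solution (m : ℕ) {g g' : ℝ → ℝ} {K : ℝ}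
    (hg : ∀ u, HasDerivAt g (g' u) u) (hg' : Continuous g') (hK : ∀ u, |g' u| ≤ K)
    (hg0 : g 0 = 0) :
    ∃ φ φ' φ'' : ℝ → ℝ, (∀ s, HasDerivAt φ (φ' s) s) ∧ (∀ s, HasDerivAt φ' (φ'' s) s) ∧
      Continuous φ'' ∧ φ 0 = 1 ∧
      (∀ s, φ' s = -(1 / 2) * radialMean m (fun r => g (φ r)) s) ∧
      ∀ s, 4 * s * φ'' s + 2 * (m + 1) * φ' s = -g (φ s) := by
  have hK0 : 0 ≤ K := (abs_nonneg _).trans (hK 0)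
  have hgL : ∀ x y, |g x - g y| ≤ K * |x - y| := fun x y => by
    simpa [Real.norm_eq_abs] using
      (convex_univ (𝕜 := ℝ)).norm_image_sub_le_of_norm_hasDerivWithin_le
        (fun u _ => (hg u).hasDerivWithinAt) (fun u _ => hK u) (mem_univ y) (mem_univ x)
  have hgc : Continuous g := continuous_iff_continuousAt.2 fun t => (hg t).continuousAt
  obtain ⟨φ, hφc, hφ⟩ := exists_radial_integral_solution m hK0 hg0 hgL
  have hRc : Continuous (radialMean m (fun r => g (φ r))) :=
    continuous_radialMean m (hgc.comp hφc)
  have h1 : ∀ s, HasDerivAt φ (-(1 / 2) * radialMean m (fun r => g (φ r)) s) s := fun s => by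
    have h := ((intervalIntegral.integral_hasDerivAt_right (hRc.intervalIntegrable 0 s)
      (hRc.stronglyMeasurableAtFilter _ _) hRc.continuousAt).const_mul (1 / 2)).const_sub 1
    rw [← funext hφ] at h
    exact h.congr_deriv (by ring)
  have hgφ : ∀ s, HasDerivAt (fun r => g (φ r))
      (g' (φ s) * (-(1 / 2) * radialMean m (fun r => g (φ r)) s)) s := fun s =>
    (hg (φ s)).comp s (h1 s)
  have hgφc : Continuous fun s => g' (φ s) * (-(1 / 2) * radialMean m (fun r => g (φ r)) s) := by
    fun_prop
  refine ⟨φ, _, _, h1, fun s => (hasDerivAt_radialMean m hgφ hgφc s).const_mul (-(1 / 2)),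
    continuous_const.mul (continuous_radialMean _ hgφc), by simpa using hφ 0, fun _ => rfl,
    fun s => ?_⟩
  have h := radialMean_deriv_identity m hgφ hgφc s
  linear_combination -h

section Laplacian

variable {n : ℕ} {φ φ' φ'' : ℝ → ℝ}

lemma hasFDerivAt_comp_norm_sq (hφ : ∀ s, HasDerivAt φ (φ' s) s)
    (x : EuclideanSpace ℝ (Fin n)) :
    HasFDerivAt (fun y : EuclideanSpace ℝ (Fin n) => φ (‖y‖ ^ 2))
      (φ' (‖x‖ ^ 2) • (2 • innerSL ℝ x)) x :=
  (hφ _).comp_hasFDerivAt x (hasStrictFDerivAt_norm_sq x).hasFDerivAt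

lemma fderiv_comp_norm_sq_single (hφ : ∀ s, HasDerivAt φ (φ' s) s)
    (x : EuclideanSpace ℝ (Fin n)) (i : Fin n) :
    fderiv ℝ (fun y : EuclideanSpace ℝ (Fin n) => φ (‖y‖ ^ 2)) x (EuclideanSpace.single i 1)
      = φ' (‖x‖ ^ 2) * (2 * x i) := by
  rw [(hasFDerivAt_comp_norm_sq hφ x).fderiv]
  simp [EuclideanSpace.inner_single_right]

/-- The Laplacian of `x ↦ φ(|x|²)`. -/
lemma lap_comp_norm_sq (hφ : ∀ s, HasDerivAt φ (φ' s) s) (hφ' : ∀ s, HasDerivAt φ' (φ'' s) s)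
    (x : EuclideanSpace ℝ (Fin n)) :
    lap (fun y => φ (‖y‖ ^ 2)) x = 4 * ‖x‖ ^ 2 * φ'' (‖x‖ ^ 2) + 2 * n * φ' (‖x‖ ^ 2) := by
  have key : ∀ i : Fin n, fderiv ℝ (fun y => fderiv ℝ
      (fun y : EuclideanSpace ℝ (Fin n) => φ (‖y‖ ^ 2)) y (EuclideanSpace.single i 1)) x
      (EuclideanSpace.single i 1) = 4 * φ'' (‖x‖ ^ 2) * x i ^ 2 + 2 * φ' (‖x‖ ^ 2) := by
    intro i
    simp only [fderiv_comp_norm_sq_single hφ]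
    have h1 : HasFDerivAt (fun y : EuclideanSpace ℝ (Fin n) => 2 * y i)
        ((2:ℝ) • (EuclideanSpace.proj i : EuclideanSpace ℝ (Fin n) →L[ℝ] ℝ)) x :=
      (EuclideanSpace.proj i : EuclideanSpace ℝ (Fin n) →L[ℝ] ℝ).hasFDerivAt.const_mul 2
    have h2 : HasFDerivAt (fun y : EuclideanSpace ℝ (Fin n) => φ' (‖y‖ ^ 2) * (2 * y i)) _ x :=
      (hasFDerivAt_comp_norm_sq hφ' x).mul h1
    rw [h2.fderiv]
    simp [EuclideanSpace.inner_single_right]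
    ring
  simp only [lap, key, Finset.sum_add_distrib, ← Finset.mul_sum,
    ← EuclideanSpace.real_norm_sq_eq]
  simp
  ring

lemma contDiff_two_of_hasDerivAt (hφ : ∀ s, HasDerivAt φ (φ' s) s)
    (hφ' : ∀ s, HasDerivAt φ' (φ'' s) s) (hc : Continuous φ'') : ContDiff ℝ 2 φ := by
  have h1 : deriv φ = φ' := funext fun s => (hφ s).deriv
  have h2 : deriv φ' = φ'' := funext fun s => (hφ' s).deriv
  have h3 : ContDiff ℝ 1 φ' :=
    contDiff_one_iff_deriv.2 ⟨fun s => (hφ' s).differentiableAt, h2 ▸ hc⟩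
  rw [show (2 : WithTop ℕ∞) = 1 + 1 by norm_num, contDiff_succ_iff_deriv, h1]
  exact ⟨fun s => (hφ s).differentiableAt, by simp, h3⟩

end Laplacian

lemma radial_solution_antitone {m : ℕ} {g φ φ' : ℝ → ℝ} (hg : ∀ u, 0 ≤ g u)
    (h1 : ∀ s, HasDerivAt φ (φ' s) s)
    (hmean : ∀ s, φ' s = -(1 / 2) * radialMean m (fun r => g (φ r)) s) : Antitone φ :=
  antitone_of_deriv_nonpos (fun s => (h1 s).differentiableAt) fun s => by
    rw [(h1 s).deriv, hmean]
    have : 0 ≤ radialMean m (fun r => g (φ r)) s :=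
      intervalIntegral.integral_nonneg zero_le_one fun τ hτ =>
        mul_nonneg (pow_nonneg hτ.1 _) (hg _)
    linarith

/-- Positivity of the radial solution for critical and supercritical exponents, by the
Pohozaev identity. -/
lemma radial_solution_pos {m : ℕ} (hm : 2 ≤ m) {p : ℝ} (hp : 2 * ((m:ℝ) + 1) ≤ p * (m - 1))
    {g φ φ' φ'' : ℝ → ℝ} (hgc : Continuous g) (hg : ∀ u, 0 ≤ g u)
    (hgp : ∀ u ∈ Icc (0:ℝ) 1, g u = p * u ^ (p - 1))
    (h1 : ∀ s, HasDerivAt φ (φ' s) s) (h2 : ∀ s, HasDerivAt φ' (φ'' s) s) (h0 : φ 0 = 1)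
    (hmean : ∀ s, φ' s = -(1 / 2) * radialMean m (fun r => g (φ r)) s)
    (hode : ∀ s, 4 * s * φ'' s + 2 * (m + 1) * φ' s = -g (φ s)) {s : ℝ} (hs : 0 ≤ s) :
    0 < φ s := by
  have hm' : (2:ℝ) ≤ m := by exact_mod_cast hm
  have hp1 : 1 ≤ p := by nlinarith
  have hφc : Continuous φ := continuous_iff_continuousAt.2 fun t => (h1 t).continuousAt
  have hanti := radial_solution_antitone hg h1 hmean
  by_contra! hle
  obtain ⟨t, ht, hφt⟩ : ∃ t ∈ Icc 0 s, φ t = 0 :=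
    intermediate_value_Icc' hs hφc.continuousOn ⟨hle, by rw [h0]; exact zero_le_one⟩
  have ht0 : 0 < t := ht.1.lt_of_ne (by rintro rfl; norm_num [h0] at hφt)
  obtain ⟨t₁, ht₁, hφt₁⟩ : ∃ t₁ ∈ Icc 0 t, φ t₁ = 1 / 2 :=
    intermediate_value_Icc' ht.1 hφc.continuousOn
      ⟨by rw [hφt]; norm_num, by rw [h0]; norm_num⟩
  have ht₁0 : 0 < t₁ := ht₁.1.lt_of_ne (by rintro rfl; norm_num [h0] at hφt₁)
  have hneg : φ' t < 0 := by
    have : 0 < radialMean m (fun r => g (φ r)) t := by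
      refine intervalIntegral.integral_pos zero_lt_one
        (Continuous.continuousOn (by fun_prop))
        (fun τ hτ => mul_nonneg (pow_nonneg hτ.1.le _) (hg _))
        ⟨√(t₁ / t), ⟨sqrt_nonneg _, ?_⟩, ?_⟩
      · rw [Real.sqrt_le_one, div_le_one ht0]
        exact ht₁.2
      · beta_reduce
        rw [sq_sqrt (by positivity), mul_div_cancel₀ _ ht0.ne', hφt₁, hgp _ (by norm_num)]
        positivity
    rw [hmean]
    linarith
  let P : ℝ → ℝ := fun r => r ^ (m + 1) *
    (2 * r ^ 2 * φ' (r ^ 2) ^ 2 + φ (r ^ 2) ^ p + (m - 1) * (φ (r ^ 2) * φ' (r ^ 2)))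
  have hP : ∀ r, φ (r ^ 2) ∈ Icc (0:ℝ) 1 → HasDerivAt P
      (r ^ m * ((m + 1 - p * (m - 1) / 2) * φ (r ^ 2) ^ p)) r := by
    intro r hr
    have hsq : HasDerivAt (fun r : ℝ => r ^ 2) (2 * r) r := by simpa using hasDerivAt_pow 2 r
    have a1 : HasDerivAt (fun r => φ (r ^ 2)) (φ' (r ^ 2) * (2 * r)) r := (h1 _).comp r hsq
    have a2 : HasDerivAt (fun r => φ' (r ^ 2)) (φ'' (r ^ 2) * (2 * r)) r := (h2 _).comp r hsq
    have a3 := a1.rpow_const (p := p) (Or.inr hp1)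
    have a4 := (hasDerivAt_pow (m + 1) r).mul
      ((((hsq.const_mul 2).mul (a2.pow 2)).add a3).add ((a1.mul a2).const_mul ((m:ℝ) - 1)))
    refine a4.congr_deriv ?_
    have hg1 := hgp _ hr
    have hmul : φ (r ^ 2) ^ p = φ (r ^ 2) * φ (r ^ 2) ^ (p - 1) := by
      rcases hr.1.eq_or_lt with h | h
      · rw [← h, zero_mul, zero_rpow (by linarith)]
      · rw [rpow_sub_one h.ne']
        field_simp
    have ho := hode (r ^ 2)
    rw [hg1] at ho
    simp only [Pi.add_apply, Pi.mul_apply, Pi.pow_apply, hmul]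
    push_cast
    simp only [pow_succ, pow_zero, one_mul]
    simp only [← sq]
    generalize φ (r ^ 2) ^ (p - 1) = A at *
    generalize φ (r ^ 2) = a at *
    generalize φ' (r ^ 2) = b at *
    generalize φ'' (r ^ 2) = c at *
    linear_combination (r ^ m * (2 * r ^ 2 * b + (m - 1) / 2 * a)) * ho
  have hmem : ∀ r ∈ Icc 0 √t, φ (r ^ 2) ∈ Icc (0:ℝ) 1 := fun r hr =>
    ⟨hφt ▸ hanti ((le_sqrt hr.1 ht.1).1 hr.2), h0 ▸ hanti (sq_nonneg r)⟩
  have hPanti : AntitoneOn P (Icc 0 √t) := by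
    refine antitoneOn_of_deriv_nonpos (convex_Icc _ _)
      (fun r hr => (hP r (hmem r hr)).continuousAt.continuousWithinAt)
      (fun r hr => (hP r (hmem r (interior_subset hr))).differentiableAt.differentiableWithinAt)
      fun r hr => ?_
    have hr' := interior_subset hr
    rw [(hP r (hmem r hr')).deriv]
    refine mul_nonpos_of_nonneg_of_nonpos (pow_nonneg hr'.1 _)
      (mul_nonpos_of_nonpos_of_nonneg (by linarith) (rpow_nonneg (hmem r hr').1 _))
  have hle := hPanti (left_mem_Icc.2 (sqrt_nonneg t)) (right_mem_Icc.2 (sqrt_nonneg t))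
    (sqrt_nonneg t)
  have : 0 < P √t := by
    simp only [P, sq_sqrt ht.1, hφt, zero_mul, mul_zero, add_zero,
      zero_rpow (show p ≠ 0 by linarith)]
    have := sq_pos_of_neg hneg
    have := sqrt_pos.2 ht0
    positivity
  have hP0 : P 0 = 0 := by simp [P]
  linarith

/-- A nonnegative `C¹` function with bounded derivative which equals `p u ^ (p - 1)` on `[0, 1]`. -/
lemma exists_lipschitz_truncation {p : ℝ} (hp : 2 < p) :
    ∃ (g g' : ℝ → ℝ) (K : ℝ), (∀ u, HasDerivAt g (g' u) u) ∧ Continuous g' ∧ (∀ u, |g' u| ≤ K) ∧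
      (∀ u, 0 ≤ g u) ∧ ∀ u ∈ Icc (0:ℝ) 1, g u = p * u ^ (p - 1) := by
  let c : ℝ → ℝ := fun u => max 0 (min u 1)
  have hc0 : ∀ u, 0 ≤ c u := fun u => le_max_left _ _
  have hc1 : ∀ u, c u ≤ 1 := fun u => max_le zero_le_one (min_le_right _ _)
  let g' : ℝ → ℝ := fun u => p * (p - 1) * c u ^ (p - 2)
  have hp1 : 0 ≤ p * (p - 1) := by nlinarith
  have hg'0 : ∀ u, 0 ≤ g' u := fun u => mul_nonneg hp1 (rpow_nonneg (hc0 u) _)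
  have hg'c : Continuous g' := by
    have : Continuous c := by fun_prop
    exact continuous_const.mul (this.rpow_const fun _ => Or.inr (by linarith))
  have hneg : ∀ u ≤ 0, g' u = 0 := fun u hu => by
    have : c u = 0 := max_eq_left ((min_le_left _ _).trans hu)
    simp only [g', this, zero_rpow (show p - 2 ≠ 0 by linarith), mul_zero]
  refine ⟨fun u => ∫ t in (0:ℝ)..u, g' t, g', p * (p - 1), fun u => ?_, hg'c, fun u => ?_,
    fun u => ?_, fun u hu => ?_⟩
  · exact intervalIntegral.integral_hasDerivAt_right (hg'c.intervalIntegrable _ _)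
      (hg'c.stronglyMeasurableAtFilter _ _) hg'c.continuousAt
  · rw [abs_of_nonneg (hg'0 u)]
    exact mul_le_of_le_one_right hp1 (rpow_le_one (hc0 u) (hc1 u) (by linarith))
  · rcases le_total 0 u with hu | hu
    · exact intervalIntegral.integral_nonneg hu fun t _ => hg'0 t
    · have : ∫ t in (0:ℝ)..u, g' t = ∫ t in (0:ℝ)..u, (0:ℝ) :=
        intervalIntegral.integral_congr fun t ht => hneg t (uIcc_of_ge hu ▸ ht).2
      simp [this]
  · have : ∫ t in (0:ℝ)..u, g' t = ∫ t in (0:ℝ)..u, p * (p - 1) * t ^ (p - 2) := by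
      refine intervalIntegral.integral_congr fun t ht => ?_
      rw [uIcc_of_le hu.1] at ht
      have : c t = t := by
        simp only [c, min_eq_left (ht.2.trans hu.2), max_eq_right ht.1]
      simp only [g', this]
    have hp2 : p - 1 ≠ 0 := by linarith
    simp only [this]
    rw [intervalIntegral.integral_const_mul, integral_rpow (Or.inl (by linarith)),
      show p - 2 + 1 = p - 1 by ring, zero_rpow hp2]
    field_simp
    ring


/-- **Existence for the Type I gradient system** coming from the potential
`F(u,v) = -(u-v)² + v^(p-1) u + u^(p-1) v`: for `p ≥ 2n/(n-2)` the system
`-Δu = -2(u-v) + v^(p-1) + (p-1) u^(p-2) v`, `-Δv = 2(u-v) + (p-1) v^(p-2) u + u^(p-1)`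
admits a positive radially symmetric C² solution in `ℝ^n`. -/
theorem typeI_example_existence (n : ℕ) (hn : 3 ≤ n) (p : ℝ)
    (hp : 2 * (n:ℝ) / ((n:ℝ) - 2) ≤ p) :
    ∃ u v : EuclideanSpace ℝ (Fin n) → ℝ,
      ContDiff ℝ 2 u ∧ ContDiff ℝ 2 v ∧
      (∀ x, 0 < u x) ∧ (∀ x, 0 < v x) ∧
      (∀ x y : EuclideanSpace ℝ (Fin n), ‖x‖ = ‖y‖ → u x = u y) ∧
      (∀ x y : EuclideanSpace ℝ (Fin n), ‖x‖ = ‖y‖ → v x = v y) ∧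
      (∀ x, - lap u x
        = -2 * (u x - v x) + v x ^ (p - 1) + (p - 1) * u x ^ (p - 2) * v x) ∧
      (∀ x, - lap v x
        = 2 * (u x - v x) + (p - 1) * v x ^ (p - 2) * u x + u x ^ (p - 1)) := by
  have hn' : (3:ℝ) ≤ n := by exact_mod_cast hn
  have hp' : 2 * (n:ℝ) ≤ p * (n - 2) := (div_le_iff₀ (by linarith)).1 hp
  have hp2 : 2 < p := by nlinarith
  obtain ⟨m, rfl⟩ : ∃ m, n = m + 1 := ⟨n - 1, by omega⟩
  push_cast at hn' hp'
  obtain ⟨g, g', K, hg, hg'c, hK, hgnn, hgp⟩ := exists_lipschitz_truncation hp2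
  have hgc : Continuous g := continuous_iff_continuousAt.2 fun t => (hg t).continuousAt
  have hg0 : g 0 = 0 := by
    rw [hgp 0 (by simp), Real.zero_rpow (by linarith), mul_zero]
  obtain ⟨φ, φ', φ'', h1, h2, hc, h0, hmean, hode⟩ := exists_radial_solution m hg hg'c hK hg0
  have hpos : ∀ x : EuclideanSpace ℝ (Fin (m + 1)), 0 < φ (‖x‖ ^ 2) := fun x =>
    radial_solution_pos (by omega) (by linarith) hgc hgnn hgp h1 h2 h0 hmean hode (sq_nonneg _)
  have hle : ∀ s, 0 ≤ s → φ s ≤ 1 := fun s hs => h0 ▸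
    radial_solution_antitone hgnn h1 hmean hs
  have hreg : ContDiff ℝ 2 fun x : EuclideanSpace ℝ (Fin (m + 1)) => φ (‖x‖ ^ 2) :=
    (contDiff_two_of_hasDerivAt h1 h2 hc).comp (contDiff_norm_sq ℝ)
  have heq : ∀ x : EuclideanSpace ℝ (Fin (m + 1)), -lap (fun y => φ (‖y‖ ^ 2)) x
      = p * φ (‖x‖ ^ 2) ^ (p - 1) := fun x => by
    rw [lap_comp_norm_sq h1 h2, ← hgp _ ⟨(hpos x).le, hle _ (sq_nonneg _)⟩]
    push_cast
    linarith [hode (‖x‖ ^ 2)]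
  have hmul : ∀ x : EuclideanSpace ℝ (Fin (m + 1)),
      φ (‖x‖ ^ 2) ^ (p - 2) * φ (‖x‖ ^ 2) = φ (‖x‖ ^ 2) ^ (p - 1) := fun x => by
    rw [← Real.rpow_add_one (hpos x).ne']
    ring_nf
  refine ⟨fun x => φ (‖x‖ ^ 2), fun x => φ (‖x‖ ^ 2), hreg, hreg, hpos, hpos,
    fun x y h => by simp only [h], fun x y h => by simp only [h], fun x => ?_, fun x => ?_⟩
  · rw [heq, mul_assoc (p - 1), hmul]
    ring
  · rw [heq, mul_assoc (p - 1), hmul]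
    ring
end
end
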